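/- arXiv:2010.14763 — 10 statements merged into one kernel-verified Lean document; each statement's English description precedes it below -/
import Mathlib

section
/- Let g > 1 be a real number, let d and m be nonnegative integers, and let M₁ ≥ d + 2 and M₀ ≥ ((m+1)·(g−1)/g)^{g/(g−1)} be real numbers. Define the delay function τ(x) = M₁ + (x + M₀)^{1/g} and the sample size sequence s_i = ⌈(1/(d+1))·((m+i+1)/(d+1)·(g−1)/g)^{1/(g−1)}⌉ for i ∈ ℕ. Then for every integer i ≥ d one has τ(∑_{j=0}^{i} s_j) ≥ 1 + ∑_{j=i−d}^{i} s_j. -/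
theorem rpow_add_one_sub_rpow_le {p u : ℝ} (hp : 1 ≤ p) (hu : 0 ≤ u) :
    (u + 1) ^ p - u ^ p ≤ p * (u + 1) ^ (p - 1) := by
  have hv : 0 < u + 1 := by linarith
  have hb : 1 + p * (-(u + 1)⁻¹) ≤ (1 + -(u + 1)⁻¹) ^ p :=
    one_add_mul_self_le_rpow_one_add (neg_le_neg (inv_le_one_of_one_le₀ (by linarith))) hp
  have he : 1 + -(u + 1)⁻¹ = u / (u + 1) := by field_simp; ring
  rw [he, Real.div_rpow hu hv.le, le_div_iff₀ (Real.rpow_pos_of_pos hv p)] at hb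
  rw [Real.rpow_sub_one hv.ne', div_eq_mul_inv]
  linarith

theorem rpow_sub_rpow_le_sum_range {p : ℝ} (hp : 1 ≤ p) (m n : ℕ) :
    ((m : ℝ) + n) ^ p - (m : ℝ) ^ p ≤
      ∑ j ∈ Finset.range n, p * ((m : ℝ) + j + 1) ^ (p - 1) := by
  induction n with
  | zero => simp
  | succ n ih =>
    rw [Finset.sum_range_succ]
    have h := rpow_add_one_sub_rpow_le (u := (m : ℝ) + n) hp (by positivity)
    push_cast
    rw [← add_assoc]
    linarith

theorem sum_ceil_le_of_monotone {f : ℕ → ℝ} (hf : Monotone f) (h0 : ∀ j, 0 ≤ f j) {d i : ℕ}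
    (hdi : d ≤ i) :
    ∑ j ∈ Finset.Icc (i - d) i, (⌈f j⌉₊ : ℝ) ≤ ((d : ℝ) + 1) * (f i + 1) := by
  have h : ∀ j ∈ Finset.Icc (i - d) i, (⌈f j⌉₊ : ℝ) ≤ f i + 1 := fun j hj =>
    (Nat.ceil_lt_add_one (h0 j)).le.trans
      (add_le_add_left (hf (Finset.mem_Icc.1 hj).2) 1)
  have hc : (Finset.Icc (i - d) i).card = d + 1 := by rw [Nat.card_Icc]; omega
  simpa [hc, mul_add] using Finset.sum_le_card_nsmul _ _ _ h


/-- Lemma "sample size sequence" (simple form, γ ≡ 1): for `g > 1`, `M₁ ≥ d + 2`,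
`M₀ ≥ ((m+1)(g-1)/g)^{g/(g-1)}`, the delay function `τ(x) = M₁ + (x + M₀)^{1/g}` and the
sample size sequence `s i = ⌈(1/(d+1))·((m+i+1)/(d+1)·(g-1)/g)^{1/(g-1)}⌉` satisfy
`τ(∑_{j=0}^{i} s_j) ≥ 1 + ∑_{j=i-d}^{i} s_j` for every `i ≥ d`. -/
theorem sample_size_property_simple
    (g : ℝ) (hg : 1 < g) (d m : ℕ) (M₁ M₀ : ℝ)
    (hM₁ : (d : ℝ) + 2 ≤ M₁)
    (hM₀ : (((m : ℝ) + 1) * (g - 1) / g) ^ (g / (g - 1)) ≤ M₀)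
    (τ : ℝ → ℝ)
    (hτ : ∀ x : ℝ, τ x = M₁ + (x + M₀) ^ (1 / g))
    (s : ℕ → ℕ)
    (hs : ∀ i : ℕ, s i =
      ⌈(1 / ((d : ℝ) + 1)) *
        ((((m : ℝ) + (i : ℝ) + 1) / ((d : ℝ) + 1)) * ((g - 1) / g)) ^ (1 / (g - 1))⌉₊) :
    ∀ i : ℕ, d ≤ i →
      1 + ∑ j ∈ Finset.Icc (i - d) i, (s j : ℝ) ≤
        τ (∑ j ∈ Finset.range (i + 1), (s j : ℝ)) := by
  intro i hi
  have hg0 : 0 < g - 1 := by linarith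
  have hgpos : 0 < g := by linarith
  set p := g / (g - 1) with hp
  have hp1 : 1 ≤ p := by rw [hp, le_div_iff₀ hg0]; linarith
  have hp0 : 0 < p := by linarith
  have ha : 1 / (g - 1) = p - 1 := by rw [hp]; field_simp; ring
  have hc : (g - 1) / g = p⁻¹ := by rw [hp, inv_div]
  have hD : (0 : ℝ) < (d : ℝ) + 1 := by positivity
  set q := p⁻¹ / ((d : ℝ) + 1) with hq
  have hq0 : 0 < q := by positivity
  set f : ℕ → ℝ := fun j => (1 / ((d : ℝ) + 1)) * (q * ((m : ℝ) + j + 1)) ^ (p - 1) with hf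
  have hsf : ∀ j, s j = ⌈f j⌉₊ := fun j => by
    rw [hs, ha, hc, hf, hq]
    congr 3
    ring
  have hf0 : ∀ j, 0 ≤ f j := fun j => by positivity
  have hmono : Monotone f := fun j k hjk => by
    have : (j : ℝ) ≤ k := by exact_mod_cast hjk
    have : 0 ≤ p - 1 := by linarith
    simp only [hf]
    gcongr
  have hfq : ∀ j, f j = q ^ p * (p * ((m : ℝ) + j + 1) ^ (p - 1)) := fun j => by
    simp only [hf]
    rw [Real.mul_rpow hq0.le (by positivity), Real.rpow_sub_one hq0.ne', hq]
    field_simp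
  have hupper : ∑ j ∈ Finset.Icc (i - d) i, (s j : ℝ) ≤
      (q * ((m : ℝ) + i + 1)) ^ (p - 1) + ((d : ℝ) + 1) := by
    simp only [hsf]
    refine (sum_ceil_le_of_monotone hmono hf0 hi).trans_eq ?_
    simp only [hf]
    field_simp
  have hlower : q ^ p * (((m : ℝ) + i + 1) ^ p - (m : ℝ) ^ p) ≤
      ∑ j ∈ Finset.range (i + 1), (s j : ℝ) := by
    have h := mul_le_mul_of_nonneg_left (rpow_sub_rpow_le_sum_range hp1 m (i + 1))
      (Real.rpow_nonneg hq0.le p)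
    rw [Finset.mul_sum] at h
    push_cast at h
    rw [← add_assoc] at h
    refine h.trans (Finset.sum_le_sum fun j _ => ?_)
    rw [← hfq, hsf]
    exact Nat.le_ceil _
  have hM : q ^ p * (m : ℝ) ^ p ≤ M₀ := by
    refine le_trans ?_ hM₀
    rw [← Real.mul_rpow hq0.le (by positivity), mul_div_assoc, hc, mul_comm]
    have : q ≤ p⁻¹ := div_le_self (by positivity) (by simp)
    gcongr
    linarith
  have hroot : (q * ((m : ℝ) + i + 1)) ^ (p - 1) ≤
      (∑ j ∈ Finset.range (i + 1), (s j : ℝ) + M₀) ^ (1 / g) := by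
    have hpg : p - 1 = p * (1 / g) := by rw [← ha, hp]; field_simp
    rw [hpg, Real.rpow_mul (by positivity)]
    refine Real.rpow_le_rpow (by positivity) ?_ (by positivity)
    rw [Real.mul_rpow hq0.le (by positivity)]
    linarith
  rw [hτ]
  linarith
end

section
/- In the setting (γ, S, s), let M₁ ≥ d + 2 and M₀ ≥ ((m+1)·(g−1)/g)^{g/(g−1)} be real numbers, and define the delay function τ(x) = M₁ + ((x + M₀)/γ(x + M₀))^{1/g}. Then for every integer i ≥ d one has τ(∑_{j=0}^{i} s_j) ≥ 1 + ∑_{j=i−d}^{i} s_j. -/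
/-- The tangent line inequality for the convex function `x ↦ x ^ q` on `[0, ∞)`. -/
lemma rpow_sub_rpow_le_mul_sub {q x y : ℝ} (hq : 1 < q) (hx : 0 ≤ x) (hy : 0 ≤ y) :
    x ^ q - y ^ q ≤ q * x ^ (q - 1) * (x - y) := by
  have hq0 : 0 < q := by linarith
  have hconj : q.HolderConjugate (q / (q - 1)) := Real.HolderConjugate.conjExponent hq
  have hyoung := Real.young_inequality_of_nonneg hy (Real.rpow_nonneg hx (q - 1)) hconj
  have hpow : (x ^ (q - 1)) ^ (q / (q - 1)) = x ^ q := by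
    rw [← Real.rpow_mul hx, mul_div_cancel₀ q (sub_pos.2 hq).ne']
  have hxq : x ^ (q - 1) * x = x ^ q := by
    rw [← Real.rpow_add_one' hx (by linarith), sub_add_cancel]
  rw [hpow] at hyoung
  have hscaled := mul_le_mul_of_nonneg_left hyoung hq0.le
  have hsplit : q * (y ^ q / q + x ^ q / (q / (q - 1))) = y ^ q + (q - 1) * x ^ q := by
    have : q - 1 ≠ 0 := (sub_pos.2 hq).ne'
    field_simp
  rw [hsplit] at hscaled
  calc x ^ q - y ^ q ≤ q * x ^ q - q * (y * x ^ (q - 1)) := by linarith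
    _ = q * x ^ (q - 1) * (x - y) := by rw [← hxq]; ring

/-- If the logarithmic derivative of `γ` is at most that of `z ^ a`, then `z ^ a / γ z` is
nondecreasing. -/
lemma monotoneOn_rpow_div {γ : ℝ → ℝ} {a : ℝ} (ha : 0 < a) (hγdiff : Differentiable ℝ γ)
    (hγpos : ∀ z, 0 ≤ z → 0 < γ z) (hγderiv : ∀ z, 0 ≤ z → z * deriv γ z ≤ a * γ z) :
    MonotoneOn (fun z => z ^ a / γ z) (Set.Ici 0) := by
  have hderiv : ∀ z ∈ interior (Set.Ici (0 : ℝ)), HasDerivAt (fun z => z ^ a / γ z)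
      ((a * z ^ (a - 1) * γ z - z ^ a * deriv γ z) / γ z ^ 2) z := by
    intro z hz
    rw [interior_Ici, Set.mem_Ioi] at hz
    exact (Real.hasDerivAt_rpow_const (Or.inl hz.ne')).div (hγdiff z).hasDerivAt
      (hγpos z hz.le).ne'
  refine monotoneOn_of_deriv_nonneg (convex_Ici 0) ?_
    (fun z hz => (hderiv z hz).differentiableAt.differentiableWithinAt) ?_
  · exact (Real.continuous_rpow_const ha.le).continuousOn.div hγdiff.continuous.continuousOn
      fun z hz => (hγpos z hz).ne'
  · intro z hz
    rw [(hderiv z hz).deriv]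
    rw [interior_Ici, Set.mem_Ioi] at hz
    have hza : z ^ a = z ^ (a - 1) * z := by
      rw [← Real.rpow_add_one hz.ne', sub_add_cancel]
    refine div_nonneg ?_ (sq_nonneg _)
    have := mul_nonneg (Real.rpow_nonneg hz.le (a - 1)) (sub_nonneg.2 (hγderiv z hz.le))
    rw [hza]
    linarith

/-- A right-endpoint Riemann sum of `u ^ (q - 1)` with step `h` dominates its integral. -/
lemma rpow_sub_rpow_le_sum {q h b : ℝ} (hq : 1 < q) (hh : 0 ≤ h) (hb : 0 ≤ b) (n : ℕ) :
    (b + n * h) ^ q - b ^ q ≤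
      ∑ j ∈ Finset.range n, q * h * (b + ((j : ℝ) + 1) * h) ^ (q - 1) := by
  induction n with
  | zero => simp
  | succ n ih =>
    rw [Finset.sum_range_succ]
    have := rpow_sub_rpow_le_mul_sub (x := b + ((n : ℝ) + 1) * h) (y := b + n * h) hq
      (by positivity) (by positivity)
    push_cast
    have heq : b + ((n : ℝ) + 1) * h - (b + n * h) = h := by ring
    rw [heq] at this
    linarith


/-- Lemma "sample size sequence" (general form): in the setting `(γ, S, s)`, for `M₁ ≥ d + 2`
and `M₀ ≥ ((m+1)(g-1)/g)^{g/(g-1)}`, the delay function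
`τ(x) = M₁ + ((x + M₀)/γ(x + M₀))^{1/g}` satisfies
`τ(∑_{j=0}^{i} s_j) ≥ 1 + ∑_{j=i-d}^{i} s_j` for every `i ≥ d`. -/
theorem sample_size_property_general
    (g : ℝ) (hg : 1 < g) (d m : ℕ) (γ : ℝ → ℝ)
    (hγdiff : Differentiable ℝ γ)
    (hγmono : MonotoneOn γ (Set.Ici (0 : ℝ)))
    (hγ1 : ∀ z : ℝ, 0 ≤ z → 1 ≤ γ z)
    (hγderiv : ∀ z : ℝ, 0 ≤ z → z * deriv γ z * g / (g - 1) ≤ γ z)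
    (ω S : ℝ → ℝ)
    (hω : ∀ x : ℝ, ω x = γ ((x * (g - 1) / g) ^ (g / (g - 1))))
    (hS : ∀ x : ℝ, S x = (x / ω x * ((g - 1) / g)) ^ (1 / (g - 1)))
    (s : ℕ → ℕ)
    (hs : ∀ i : ℕ, s i =
      ⌈(1 / ((d : ℝ) + 1)) * S (((m : ℝ) + (i : ℝ) + 1) / ((d : ℝ) + 1))⌉₊)
    (M₁ M₀ : ℝ)
    (hM₁ : (d : ℝ) + 2 ≤ M₁)
    (hM₀ : (((m : ℝ) + 1) * (g - 1) / g) ^ (g / (g - 1)) ≤ M₀)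
    (τ : ℝ → ℝ)
    (hτ : ∀ x : ℝ, τ x = M₁ + ((x + M₀) / γ (x + M₀)) ^ (1 / g)) :
    ∀ i : ℕ, d ≤ i →
      1 + ∑ j ∈ Finset.Icc (i - d) i, (s j : ℝ) ≤
        τ (∑ j ∈ Finset.range (i + 1), (s j : ℝ)) := by
  intro i hi
  have hg0 : 0 < g := by linarith
  have hg1 : 0 < g - 1 := by linarith
  have hD : (0 : ℝ) < (d : ℝ) + 1 := by positivity
  have hγpos : ∀ z : ℝ, 0 ≤ z → 0 < γ z := fun z hz => one_pos.trans_le (hγ1 z hz)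
  set q : ℝ := g / (g - 1) with hq_def
  have hq : 1 < q := (one_lt_div hg1).2 (by linarith)
  have hq1 : q - 1 = 1 / (g - 1) := by rw [hq_def]; field_simp; ring
  have hq0 : 0 < q := by linarith
  have hqg : q * (1 / g) = 1 / (g - 1) := by rw [hq_def]; field_simp
  have ha : (g - 1) / g = q⁻¹ := by rw [hq_def, inv_div]
  have hderiv : ∀ z, 0 ≤ z → z * deriv γ z ≤ q⁻¹ * γ z := by
    intro z hz
    have h := hγderiv z hz
    rw [mul_div_assoc, ← hq_def] at h
    rw [inv_mul_eq_div, le_div_iff₀ hq0]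
    exact h
  have hmono := monotoneOn_rpow_div (inv_pos.2 hq0) hγdiff hγpos hderiv
  have hmono1 := monotoneOn_rpow_div one_pos hγdiff hγpos fun z hz =>
    (hderiv z hz).trans
      (mul_le_mul_of_nonneg_right (inv_le_one_of_one_le₀ hq.le) (hγpos z hz).le)
  simp only [Real.rpow_one] at hmono1
  have hS' : ∀ x : ℝ, S x = (x * q⁻¹ / γ ((x * q⁻¹) ^ q)) ^ (q - 1) := by
    intro x
    rw [hS, hω, mul_div_assoc, ha, hq1, div_mul_eq_mul_div]
  have hSmono : MonotoneOn S (Set.Ici 0) := by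
    intro x hx y hy hxy
    rw [Set.mem_Ici] at hx hy
    have hxq : 0 ≤ x * q⁻¹ := by positivity
    have hyq : 0 ≤ y * q⁻¹ := by positivity
    have hle := hmono (Real.rpow_nonneg hxq q) (Real.rpow_nonneg hyq q)
      (Real.rpow_le_rpow hxq (by gcongr) hq0.le)
    simp only [Real.rpow_rpow_inv hxq hq0.ne', Real.rpow_rpow_inv hyq hq0.ne'] at hle
    rw [hS', hS']
    exact Real.rpow_le_rpow (div_nonneg hxq (hγpos _ (Real.rpow_nonneg hxq q)).le) hle
      (by linarith)
  have hSnonneg : ∀ x, 0 ≤ x → 0 ≤ S x := by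
    intro x hx
    rw [hS']
    have hxq : 0 ≤ x * q⁻¹ := by positivity
    exact Real.rpow_nonneg (div_nonneg hxq (hγpos _ (Real.rpow_nonneg hxq q)).le) _
  set t : ℕ → ℝ := fun j => ((m : ℝ) + (j : ℝ) + 1) / ((d : ℝ) + 1) with ht
  have ht0 : ∀ j, 0 ≤ t j := fun j => by simp only [ht]; positivity
  have htmono : ∀ j, j ≤ i → t j ≤ t i := fun j hj => by simp only [ht]; gcongr
  have hs' : ∀ j, s j = ⌈(1 / ((d : ℝ) + 1)) * S (t j)⌉₊ := hs
  have hSt : 0 ≤ S (t i) := hSnonneg _ (ht0 i)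
  have hupper : ∑ j ∈ Finset.Icc (i - d) i, (s j : ℝ) ≤ (d : ℝ) + 1 + S (t i) := by
    have hterm : ∀ j ∈ Finset.Icc (i - d) i,
        (s j : ℝ) ≤ (1 / ((d : ℝ) + 1)) * S (t i) + 1 := by
      intro j hj
      have hji := (Finset.mem_Icc.1 hj).2
      have h1 := Nat.ceil_lt_add_one (mul_nonneg (one_div_pos.2 hD).le (hSnonneg _ (ht0 j)))
      have h2 := mul_le_mul_of_nonneg_left (hSmono (ht0 j) (ht0 i) (htmono j hji))
        (one_div_pos.2 hD).le
      rw [hs']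
      linarith
    have hcard : (Finset.Icc (i - d) i).card = d + 1 := by
      rw [Nat.card_Icc]; omega
    refine (Finset.sum_le_card_nsmul _ _ _ hterm).trans_eq ?_
    rw [hcard, nsmul_eq_mul]
    push_cast
    field_simp
    ring
  set b : ℝ := t i * q⁻¹ with hb
  have hb0 : 0 ≤ b := mul_nonneg (ht0 i) (inv_pos.2 hq0).le
  set z : ℝ := b ^ q with hz
  have hz0 : 0 ≤ z := Real.rpow_nonneg hb0 q
  set c : ℝ := γ z ^ (q - 1) with hc
  have hc1 : 1 ≤ c := Real.one_le_rpow (hγ1 z hz0) (by linarith)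
  have hc0 : 0 < c := by linarith
  set h : ℝ := q⁻¹ / ((d : ℝ) + 1) with hh
  have hh0 : 0 ≤ h := by positivity
  have htq : ∀ j : ℕ, t j * q⁻¹ = m * h + ((j : ℝ) + 1) * h := fun j => by
    simp only [ht, hh]; ring
  have hlower : (z - (m * h) ^ q) / c ≤ ∑ j ∈ Finset.range (i + 1), (s j : ℝ) := by
    have hsum := rpow_sub_rpow_le_sum (b := m * h) hq hh0 (by positivity) (i + 1)
    push_cast at hsum
    rw [← htq i] at hsum
    refine (div_le_div_of_nonneg_right hsum hc0.le).trans ?_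
    rw [Finset.sum_div]
    refine Finset.sum_le_sum fun j hj => ?_
    have hji : j ≤ i := by have := Finset.mem_range.1 hj; omega
    rw [hs', ← htq j]
    refine le_trans ?_ (Nat.le_ceil _)
    have hqh : q * h = 1 / ((d : ℝ) + 1) := by rw [hh]; field_simp
    have htj : 0 ≤ t j * q⁻¹ := mul_nonneg (ht0 j) (inv_pos.2 hq0).le
    have hγj := hγpos _ (Real.rpow_nonneg htj q)
    rw [hqh, mul_div_assoc, hS', Real.div_rpow htj hγj.le]
    have hγle : γ ((t j * q⁻¹) ^ q) ≤ γ z :=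
      hγmono (Real.rpow_nonneg htj q) hz0 (Real.rpow_le_rpow htj
        (mul_le_mul_of_nonneg_right (htmono j hji) (inv_pos.2 hq0).le) hq0.le)
    refine mul_le_mul_of_nonneg_left ?_ (one_div_pos.2 hD).le
    exact div_le_div_of_nonneg_left (Real.rpow_nonneg htj _) (Real.rpow_pos_of_pos hγj _)
      (Real.rpow_le_rpow hγj.le hγle (by linarith))
  have hM₀' : (m * h) ^ q / c ≤ M₀ := by
    refine (div_le_self (by positivity) hc1).trans (le_trans ?_ hM₀)
    rw [mul_div_assoc, ha]
    refine Real.rpow_le_rpow (by positivity) ?_ hq0.le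
    refine mul_le_mul (by linarith) ?_ hh0 (by positivity)
    exact div_le_self (inv_pos.2 hq0).le (by linarith [Nat.cast_nonneg (α := ℝ) d])
  set X : ℝ := ∑ j ∈ Finset.range (i + 1), (s j : ℝ) with hX
  have hY0 : 0 ≤ z / c := by positivity
  have hYX : z / c ≤ X + M₀ := by
    rw [sub_div] at hlower
    linarith
  have hγz := hγpos z hz0
  have hkey : S (t i) ≤ ((X + M₀) / γ (X + M₀)) ^ (1 / g) := by
    have hSpow : S (t i) = (z / c / γ z) ^ (1 / g) := by
      have hzc : z / c / γ z = (b / γ z) ^ q := by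
        rw [Real.div_rpow hb0 hγz.le, div_div, hc, ← Real.rpow_add_one hγz.ne',
          sub_add_cancel]
      rw [hzc, ← Real.rpow_mul (div_nonneg hb0 hγz.le), hqg, ← hq1, hS']
    rw [hSpow]
    refine Real.rpow_le_rpow (by positivity) ?_ (by positivity)
    have hYz : γ (z / c) ≤ γ z := hγmono hY0 hz0 (div_le_self hz0 hc1)
    exact (div_le_div_of_nonneg_left hY0 (hγpos _ hY0) hYz).trans
      (hmono1 hY0 (hY0.trans hYX) hYX)
  rw [hτ]
  linarith
end

section
/- In the setting (γ, S, s), let E : ℕ → ℝ be nondecreasing with E_t ≥ 1 for all t; define Ē_i = E_{A_i} for i ≥ 0 and Ē_{−1} = E_0, and assume Ē_i ≤ 2·Ē_{i−1} for all i ≥ 0 and s₀ − 1 ≤ E₀. Let q ≥ 0 and a₀ > 0 be reals and set a₁ = a₀ · (max{3, 1 + ((m+2)/(m+1))^{1/(g−1)}})^q. For each t ∈ ℕ let i(t) be the unique index i with A_{i−1} ≤ t < A_i, and define α_t = a₀ · (t + E_t)^q / (A_{i(t)−1} + Ē_{i(t)−1})^q. Then a₀ ≤ α_t ≤ a₁ for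 all t ∈ ℕ, and α₀ = a₀. -/
/-- If `w` does not decrease between `x` and `y`, the power `(x / w x * c) ^ p` grows by at most
the factor `(y / x) ^ p`. -/
theorem div_mul_rpow_le_of_le {x y wx wy c p : ℝ} (hx : 0 < x) (hy : 0 < y) (hwx : 0 < wx)
    (hw : wx ≤ wy) (hc : 0 ≤ c) (hp : 0 ≤ p) :
    (y / wy * c) ^ p ≤ (y / x) ^ p * (x / wx * c) ^ p := by
  have hwy : 0 < wy := hwx.trans_le hw
  rw [← Real.mul_rpow (by positivity) (by positivity)]
  refine Real.rpow_le_rpow (by positivity) ?_ hp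
  calc y / wy * c ≤ y / wx * c := by gcongr
    _ = y / x * (x / wx * c) := by field_simp

theorem natCast_ceil_sub_one_le {a b r : ℝ} (hb : 0 ≤ b) (hr : 0 ≤ r) (hba : b ≤ r * a) :
    (⌈b⌉₊ : ℝ) - 1 ≤ r * ⌈a⌉₊ := by
  have h1 := Nat.ceil_lt_add_one hb
  have h2 : r * a ≤ r * ⌈a⌉₊ := mul_le_mul_of_nonneg_left (Nat.le_ceil a) hr
  linarith

/-- Every natural number lies in some interval between consecutive partial sums of a sequence of
positive natural numbers. -/
theorem exists_sum_range_le_lt_of_pos {s : ℕ → ℕ} (hs : ∀ i, 0 < s i) (t : ℕ) :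
    ∃ i, ∑ j ∈ Finset.range i, s j ≤ t ∧ t < ∑ j ∈ Finset.range (i + 1), s j := by
  induction t with
  | zero => exact ⟨0, by simp, by simpa using hs 0⟩
  | succ t ih =>
    obtain ⟨i, hi, hlt⟩ := ih
    by_cases h : t + 1 < ∑ j ∈ Finset.range (i + 1), s j
    · exact ⟨i, by omega, h⟩
    · refine ⟨i + 1, by omega, ?_⟩
      rw [Finset.sum_range_succ]
      have := hs (i + 1)
      omega

theorem le_mul_rpow_div_rpow_le {a x y M q : ℝ} (ha : 0 ≤ a) (hx : 0 < x) (hxy : x ≤ y)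
    (hyM : y ≤ M * x) (hq : 0 ≤ q) :
    a ≤ a * y ^ q / x ^ q ∧ a * y ^ q / x ^ q ≤ a * M ^ q := by
  have hM : 0 ≤ M := le_of_mul_le_mul_right (by linarith) hx
  have hxq : 0 < x ^ q := Real.rpow_pos_of_pos hx q
  constructor
  · rw [le_div_iff₀ hxq]
    gcongr
  · rw [div_le_iff₀ hxq, mul_assoc, ← Real.mul_rpow hM hx.le]
    exact mul_le_mul_of_nonneg_left (Real.rpow_le_rpow (hx.le.trans hxy) hyM hq) ha

/-- Lemma "round step size" (general `q ≥ 0`): in the setting `(γ, S, s)`, with a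
nondecreasing sequence `E_t ≥ 1`, `Ē_i = E_{A_i}` (with `Ē_{-1} = E_0`) satisfying
`Ē_i ≤ 2·Ē_{i-1}` and `s₀ - 1 ≤ E₀`, for `q ≥ 0`, `a₀ > 0` and
`a₁ = a₀ · (max{3, 1 + ((m+2)/(m+1))^{1/(g-1)}})^q`, the coefficients
`α_t = a₀·(t+E_t)^q/(A_{i(t)-1} + Ē_{i(t)-1})^q` (where `i(t)` is the unique round with
`A_{i(t)-1} ≤ t < A_{i(t)}`) satisfy `a₀ ≤ α_t ≤ a₁`, and `α₀ = a₀`.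
Here `P : ℕ → ℕ` encodes the partial sums `P i = ∑_{j=0}^{i-1} s_j = A_{i-1}` (so `P 0 = A_{-1} = 0`),
and `Ebar : ℕ → ℝ` encodes `Ebar i = E_{P i} = Ē_{i-1}` (so `Ebar 0 = Ē_{-1} = E₀`). -/
theorem round_step_size_coefficients
    (g : ℝ) (hg : 1 < g) (d m : ℕ) (γ : ℝ → ℝ)
    (hγdiff : Differentiable ℝ γ)
    (hγmono : MonotoneOn γ (Set.Ici (0 : ℝ)))
    (hγ1 : ∀ z : ℝ, 0 ≤ z → 1 ≤ γ z)
    (hγderiv : ∀ z : ℝ, 0 ≤ z → z * deriv γ z * g / (g - 1) ≤ γ z)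
    (ω S : ℝ → ℝ)
    (hω : ∀ x : ℝ, ω x = γ ((x * (g - 1) / g) ^ (g / (g - 1))))
    (hS : ∀ x : ℝ, S x = (x / ω x * ((g - 1) / g)) ^ (1 / (g - 1)))
    (s : ℕ → ℕ)
    (hs : ∀ i : ℕ, s i =
      ⌈(1 / ((d : ℝ) + 1)) * S (((m : ℝ) + (i : ℝ) + 1) / ((d : ℝ) + 1))⌉₊)
    (P : ℕ → ℕ) (hP : ∀ i : ℕ, P i = ∑ j ∈ Finset.range i, s j)
    (E : ℕ → ℝ) (hEmono : Monotone E) (hE1 : ∀ t : ℕ, 1 ≤ E t)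
    (Ebar : ℕ → ℝ) (hEbar : ∀ i : ℕ, Ebar i = E (P i))
    (hEbar2 : ∀ i : ℕ, Ebar (i + 1) ≤ 2 * Ebar i)
    (hs0E0 : (s 0 : ℝ) - 1 ≤ E 0)
    (q a₀ a₁ : ℝ) (hq : 0 ≤ q) (ha₀ : 0 < a₀)
    (ha₁ : a₁ = a₀ * (max 3 (1 + (((m : ℝ) + 2) / ((m : ℝ) + 1)) ^ (1 / (g - 1)))) ^ q)
    (α : ℕ → ℝ)
    (hα : ∀ t i : ℕ, P i ≤ t → t < P (i + 1) →
      α t = a₀ * ((t : ℝ) + E t) ^ q / ((P i : ℝ) + Ebar i) ^ q) :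
    (∀ t : ℕ, a₀ ≤ α t ∧ α t ≤ a₁) ∧ α 0 = a₀ := by
  have hg0 : 0 < g - 1 := sub_pos.mpr hg
  have hg' : 0 < g := zero_lt_one.trans hg
  have hp : 0 ≤ 1 / (g - 1) := by positivity
  have hc : 0 < (g - 1) / g := by positivity
  have hω1 : ∀ x, 0 ≤ x → 1 ≤ ω x := fun x hx => by
    rw [hω]
    exact hγ1 _ (by positivity)
  have hωmono : ∀ x y, 0 ≤ x → x ≤ y → ω x ≤ ω y := fun x y hx hxy => by
    have hy : 0 ≤ y := hx.trans hxy
    rw [hω, hω]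
    refine hγmono (Set.mem_Ici.mpr (by positivity)) (Set.mem_Ici.mpr (by positivity)) ?_
    gcongr
  have hSpos : ∀ x, 0 < x → 0 < S x := fun x hx => by
    have := hω1 x hx.le
    rw [hS]
    positivity
  have hspos : ∀ i, 0 < s i := fun i => by
    have := hSpos (((m : ℝ) + i + 1) / (d + 1)) (by positivity)
    rw [hs, Nat.ceil_pos]
    positivity
  set r : ℝ := (((m : ℝ) + 2) / ((m : ℝ) + 1)) ^ (1 / (g - 1))
  have hr0 : 0 ≤ r := by positivity
  have hP0 : P 0 = 0 := by simp [hP]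
  have hPsucc : ∀ i, P (i + 1) = P i + s i := fun i => by
    rw [hP, hP, Finset.sum_range_succ]
  have hssucc : ∀ i, (s (i + 1) : ℝ) - 1 ≤ r * s i := fun i => by
    have hx : (0 : ℝ) < (m + i + 1) / (d + 1) := by positivity
    have hy : (0 : ℝ) < (m + (i + 1 : ℕ) + 1) / (d + 1) := by positivity
    have hxy : ((m : ℝ) + i + 1) / (d + 1) ≤ (m + (i + 1 : ℕ) + 1) / (d + 1) := by
      gcongr
      simp
    have hratio : ((m : ℝ) + (i + 1 : ℕ) + 1) / (d + 1) / ((m + i + 1) / (d + 1))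
        ≤ (m + 2) / (m + 1) := by
      rw [div_div_div_cancel_right₀ (by positivity), div_le_div_iff₀ (by positivity)
        (by positivity)]
      push_cast
      nlinarith [(Nat.cast_nonneg i : (0 : ℝ) ≤ i)]
    have hSle : S ((m + (i + 1 : ℕ) + 1) / (d + 1)) ≤ r * S ((m + i + 1) / (d + 1)) := by
      rw [hS, hS]
      refine (div_mul_rpow_le_of_le hx hy (zero_lt_one.trans_le (hω1 _ hx.le))
        (hωmono _ _ hx.le hxy) hc.le hp).trans ?_
      have := hω1 _ hx.le
      exact mul_le_mul_of_nonneg_right (Real.rpow_le_rpow (by positivity) hratio hp)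
        (by positivity)
    rw [hs, hs]
    refine natCast_ceil_sub_one_le (mul_nonneg (by positivity) (hSpos _ hy).le) hr0 ?_
    rw [mul_left_comm]
    exact mul_le_mul_of_nonneg_left hSle (by positivity)
  have hbound : ∀ i, (s i : ℝ) - 1 ≤ r * P i + E 0 := fun i => by
    cases i with
    | zero => simpa [hP0] using hs0E0
    | succ i =>
      have hle : (s i : ℝ) ≤ P (i + 1) := by
        rw [hPsucc]
        exact_mod_cast Nat.le_add_left _ _
      have := mul_le_mul_of_nonneg_left hle hr0
      linarith [hssucc i, hE1 0]
  refine ⟨fun t => ?_, ?_⟩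
  · obtain ⟨i, hi, hlt⟩ := exists_sum_range_le_lt_of_pos hspos t
    rw [← hP] at hi hlt
    have hiR : (P i : ℝ) ≤ t := by exact_mod_cast hi
    have hltR : (t : ℝ) + 1 ≤ P i + s i := by
      have : t + 1 ≤ P i + s i := by rw [← hPsucc]; exact hlt
      exact_mod_cast this
    have hElo : Ebar i ≤ E t := by rw [hEbar]; exact hEmono hi
    have hEhi : E t ≤ 2 * Ebar i :=
      (hEmono hlt.le).trans (by rw [← hEbar]; exact hEbar2 i)
    have hE0 : E 0 ≤ Ebar i := by rw [hEbar]; exact hEmono (Nat.zero_le _)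
    have hEpos : 1 ≤ Ebar i := (hE1 0).trans hE0
    have hP0' : (0 : ℝ) ≤ P i := Nat.cast_nonneg _
    have h3 := mul_le_mul_of_nonneg_right (le_max_left 3 (1 + r)) (zero_le_one.trans hEpos)
    have h1r := mul_le_mul_of_nonneg_right (le_max_right 3 (1 + r)) hP0'
    rw [hα t i hi hlt, ha₁]
    refine le_mul_rpow_div_rpow_le ha₀.le (by linarith) (by linarith) ?_ hq
    linarith [hbound i]
  · have h0 : 0 < P (0 + 1) := by rw [hPsucc, hP0, zero_add]; exact hspos 0
    have hE0 : E 0 ^ q ≠ 0 := (Real.rpow_pos_of_pos (zero_lt_one.trans_le (hE1 0)) q).ne'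
    rw [hα 0 0 hP0.le h0, hEbar, hP0, Nat.cast_zero, zero_add, mul_div_cancel_right₀ _ hE0]
end

section
/- In the setting (γ, S, s) with additionally g ≥ 2, let E : ℕ → ℝ be nondecreasing with E_t ≥ 1 for all t; define Ē_i = E_{A_i} for i ≥ 0 and Ē_{−1} = E_0, and assume Ē_i ≤ 2·Ē_{i−1} for all i ≥ 0 and s₀ − 1 ≤ E₀. Let 0 ≤ q ≤ 1 and a₀ > 0 be reals. For each t ∈ ℕ let i(t) be the unique index i with A_{i−1} ≤ t < A_i, and define α_t = a₀ · (t + E_t)^q / (A_{i(t)−1} + Ē_{i(t)−1})^q. Then a₀ ≤ α_t ≤ 3·a₀ for all t ∈ ℕ; equivalently, the diminishing step size sequence η_t = α_t/(μ·(t + E_t)^q) (for any μ > 0) satisfies η_t = a₀/(μ·(A_{i−1} + Ē_{i−1})^q) for all t with A_{i−1} ≤ t < A_i, and its coefficients α_t lie in [α₀, 3·α₀]. -/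
theorem Real.mul_rpow_le_mul_rpow {c x p : ℝ} (hc : 1 ≤ c) (hx : 0 ≤ x) (hp : p ≤ 1) :
    (c * x) ^ p ≤ c * x ^ p := by
  rw [Real.mul_rpow (by linarith) hx]
  have h : c ^ p ≤ c := by
    simpa using Real.rpow_le_rpow_of_exponent_le hc hp
  exact mul_le_mul_of_nonneg_right h (Real.rpow_nonneg hx p)

theorem Real.rpow_div_mul_le_of_le_two_mul {ω : ℝ → ℝ} {x y c p : ℝ}
    (hx : 0 < x) (hxy : x ≤ y) (hyx : y ≤ 2 * x) (hω : 0 < ω x) (hωxy : ω x ≤ ω y)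
    (hc : 0 ≤ c) (hp0 : 0 ≤ p) (hp1 : p ≤ 1) :
    (y / ω y * c) ^ p ≤ 2 * (x / ω x * c) ^ p := by
  have hωy : 0 < ω y := hω.trans_le hωxy
  have hy : 0 < y := hx.trans_le hxy
  have h : y / ω y ≤ 2 * x / ω x := div_le_div₀ (by positivity) hyx hω hωxy
  calc (y / ω y * c) ^ p ≤ (2 * (x / ω x * c)) ^ p := by
        refine Real.rpow_le_rpow (by positivity) ?_ hp0
        calc y / ω y * c ≤ 2 * x / ω x * c := mul_le_mul_of_nonneg_right h hc
          _ = 2 * (x / ω x * c) := by ring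
    _ ≤ 2 * (x / ω x * c) ^ p :=
        Real.mul_rpow_le_mul_rpow one_le_two (by positivity) hp1

theorem StrictMono.exists_le_lt_succ {P : ℕ → ℕ} (hP : StrictMono P) (h0 : P 0 = 0) (t : ℕ) :
    ∃ i, P i ≤ t ∧ t < P (i + 1) := by
  induction t with
  | zero => exact ⟨0, h0.le, by simpa [h0] using hP zero_lt_one⟩
  | succ t ih =>
    obtain ⟨i, hi, hti⟩ := ih
    rcases Nat.lt_or_ge (t + 1) (P (i + 1)) with h | h
    · exact ⟨i, by omega, h⟩
    · exact ⟨i + 1, h, by have := hP (Nat.lt_add_one (i + 1)); omega⟩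

/-- Lemma "round step size" (case `g ≥ 2`, `0 ≤ q ≤ 1`): in the setting `(γ, S, s)` with
`g ≥ 2`, with a nondecreasing sequence `E_t ≥ 1`, `Ē_i = E_{A_i}` (with `Ē_{-1} = E₀`)
satisfying `Ē_i ≤ 2·Ē_{i-1}` and `s₀ - 1 ≤ E₀`, for `0 ≤ q ≤ 1` and `a₀ > 0`, the
coefficients `α_t = a₀·(t+E_t)^q/(A_{i(t)-1} + Ē_{i(t)-1})^q` satisfy `a₀ ≤ α_t ≤ 3·a₀`;
equivalently, for any `μ > 0` the step sizes `η_t = α_t/(μ·(t+E_t)^q)` satisfy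
`η_t = a₀/(μ·(A_{i-1} + Ē_{i-1})^q)` on round `i` and `α_t ∈ [α₀, 3·α₀]`.
Here `P i = ∑_{j=0}^{i-1} s_j = A_{i-1}` (so `P 0 = 0`) and `Ebar i = E_{P i} = Ē_{i-1}`. -/
theorem round_step_size_coefficients_three
    (g : ℝ) (hg : 1 < g) (hg2 : 2 ≤ g) (d m : ℕ) (γ : ℝ → ℝ)
    (hγdiff : Differentiable ℝ γ)
    (hγmono : MonotoneOn γ (Set.Ici (0 : ℝ)))
    (hγ1 : ∀ z : ℝ, 0 ≤ z → 1 ≤ γ z)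
    (hγderiv : ∀ z : ℝ, 0 ≤ z → z * deriv γ z * g / (g - 1) ≤ γ z)
    (ω S : ℝ → ℝ)
    (hω : ∀ x : ℝ, ω x = γ ((x * (g - 1) / g) ^ (g / (g - 1))))
    (hS : ∀ x : ℝ, S x = (x / ω x * ((g - 1) / g)) ^ (1 / (g - 1)))
    (s : ℕ → ℕ)
    (hs : ∀ i : ℕ, s i =
      ⌈(1 / ((d : ℝ) + 1)) * S (((m : ℝ) + (i : ℝ) + 1) / ((d : ℝ) + 1))⌉₊)
    (P : ℕ → ℕ) (hP : ∀ i : ℕ, P i = ∑ j ∈ Finset.range i, s j)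
    (E : ℕ → ℝ) (hEmono : Monotone E) (hE1 : ∀ t : ℕ, 1 ≤ E t)
    (Ebar : ℕ → ℝ) (hEbar : ∀ i : ℕ, Ebar i = E (P i))
    (hEbar2 : ∀ i : ℕ, Ebar (i + 1) ≤ 2 * Ebar i)
    (hs0E0 : (s 0 : ℝ) - 1 ≤ E 0)
    (q a₀ : ℝ) (hq0 : 0 ≤ q) (hq1 : q ≤ 1) (ha₀ : 0 < a₀)
    (α : ℕ → ℝ)
    (hα : ∀ t i : ℕ, P i ≤ t → t < P (i + 1) →
      α t = a₀ * ((t : ℝ) + E t) ^ q / ((P i : ℝ) + Ebar i) ^ q) :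
    (∀ t : ℕ, a₀ ≤ α t ∧ α t ≤ 3 * a₀) ∧
    (∀ μ : ℝ, 0 < μ → ∀ t i : ℕ, P i ≤ t → t < P (i + 1) →
      α t / (μ * ((t : ℝ) + E t) ^ q) = a₀ / (μ * ((P i : ℝ) + Ebar i) ^ q)) := by
  have hg1 : 0 < g - 1 := by linarith
  have hc : 0 < (g - 1) / g := by positivity
  have hp0 : 0 ≤ 1 / (g - 1) := by positivity
  have hp1 : 1 / (g - 1) ≤ 1 := by rw [div_le_one hg1]; linarith
  have hz : ∀ x : ℝ, 0 ≤ x → 0 ≤ (x * (g - 1) / g) ^ (g / (g - 1)) := fun x hx => by positivity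
  have hωpos : ∀ x : ℝ, 0 ≤ x → 0 < ω x := fun x hx => by
    rw [hω]; exact zero_lt_one.trans_le (hγ1 _ (hz x hx))
  have hωmono : ∀ x y : ℝ, 0 ≤ x → x ≤ y → ω x ≤ ω y := fun x y hx hxy => by
    rw [hω, hω]
    refine hγmono (hz x hx) (hz y (hx.trans hxy)) ?_
    gcongr
  have hSpos : ∀ x : ℝ, 0 < x → 0 < S x := fun x hx => by
    have := hωpos x hx.le
    rw [hS]; positivity
  have hSdouble : ∀ x y : ℝ, 0 < x → x ≤ y → y ≤ 2 * x → S y ≤ 2 * S x :=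
    fun x y hx hxy hyx => by
      rw [hS, hS]
      exact Real.rpow_div_mul_le_of_le_two_mul hx hxy hyx (hωpos x hx.le)
        (hωmono x y hx.le hxy) hc.le hp0 hp1
  have hspos : ∀ i, 0 < s i := fun i => by
    rw [hs, Nat.ceil_pos]
    have := hSpos (((m : ℝ) + (i : ℝ) + 1) / ((d : ℝ) + 1)) (by positivity)
    positivity
  have hPsucc : ∀ i, P (i + 1) = P i + s i := fun i => by
    rw [hP, hP, Finset.sum_range_succ]
  have hP0 : P 0 = 0 := by simp [hP]
  have hPmono : StrictMono P := strictMono_nat_of_lt_succ fun i => by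
    have := hspos i
    have := hPsucc i
    omega
  have hsgrowth : ∀ i, (s (i + 1) : ℝ) - 1 ≤ 2 * s i := fun i => by
    have hxpos : (0 : ℝ) < ((m : ℝ) + (i : ℝ) + 1) / ((d : ℝ) + 1) := by positivity
    have hm : (0 : ℝ) ≤ m := m.cast_nonneg
    have hi : (0 : ℝ) ≤ i := i.cast_nonneg
    have hdouble := hSdouble (((m : ℝ) + (i : ℝ) + 1) / ((d : ℝ) + 1))
      (((m : ℝ) + ((i + 1 : ℕ) : ℝ) + 1) / ((d : ℝ) + 1)) hxpos
      (by push_cast; gcongr; linarith)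
      (by push_cast; rw [← mul_div_assoc]; gcongr; linarith)
    have hupper : (s (i + 1) : ℝ) < 1 / ((d : ℝ) + 1) *
        S (((m : ℝ) + ((i + 1 : ℕ) : ℝ) + 1) / ((d : ℝ) + 1)) + 1 := by
      rw [hs (i + 1)]
      refine Nat.ceil_lt_add_one ?_
      have := hSpos (((m : ℝ) + ((i + 1 : ℕ) : ℝ) + 1) / ((d : ℝ) + 1)) (by positivity)
      positivity
    have hlower : 1 / ((d : ℝ) + 1) * S (((m : ℝ) + (i : ℝ) + 1) / ((d : ℝ) + 1)) ≤ s i := by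
      rw [hs i]
      exact Nat.le_ceil _
    have hscaled := mul_le_mul_of_nonneg_left hdouble
      (by positivity : (0 : ℝ) ≤ 1 / ((d : ℝ) + 1))
    linarith
  have hsbound : ∀ i, (s i : ℝ) - 1 ≤ 2 * P i + Ebar i := fun i => by
    have hE := hE1 (P i)
    rw [← hEbar] at hE
    cases i with
    | zero => simpa [hEbar, hP0] using hs0E0
    | succ i =>
      have hcast : (P (i + 1) : ℝ) = P i + s i := by exact_mod_cast hPsucc i
      have hPi : (0 : ℝ) ≤ P i := (P i).cast_nonneg
      have := hsgrowth i
      linarith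
  refine ⟨fun t => ?_, fun μ hμ t i hit hti => ?_⟩
  · obtain ⟨i, hit, hti⟩ := hPmono.exists_le_lt_succ hP0 t
    rw [hα t i hit hti, mul_div_assoc]
    have hD : (0 : ℝ) < (P i : ℝ) + Ebar i := by
      have := hE1 (P i)
      rw [hEbar]; positivity
    have hlo : (P i : ℝ) + Ebar i ≤ t + E t := by
      rw [hEbar]
      exact add_le_add (by exact_mod_cast hit) (hEmono hit)
    have hhi : (t : ℝ) + E t ≤ 3 * ((P i : ℝ) + Ebar i) := by
      have ht : (t : ℝ) + 1 ≤ P i + s i := by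
        have := hPsucc i
        exact_mod_cast (by omega : t + 1 ≤ P i + s i)
      have hEt : E t ≤ Ebar (i + 1) := hEbar (i + 1) ▸ hEmono hti.le
      have := hEbar2 i
      have := hsbound i
      linarith
    have hDq : 0 < ((P i : ℝ) + Ebar i) ^ q := Real.rpow_pos_of_pos hD q
    constructor
    · refine le_mul_of_one_le_right ha₀.le ((one_le_div hDq).2 ?_)
      exact Real.rpow_le_rpow hD.le hlo hq0
    · rw [mul_comm 3 a₀]
      refine mul_le_mul_of_nonneg_left ((div_le_iff₀ hDq).2 ?_) ha₀.le
      exact (Real.rpow_le_rpow (hD.le.trans hlo) hhi hq0).trans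
        (Real.mul_rpow_le_mul_rpow (by norm_num) hD.le hq1)
  · have hN : 0 < ((t : ℝ) + E t) ^ q :=
      Real.rpow_pos_of_pos (by have := hE1 t; positivity) q
    rw [hα t i hit hti]
    field_simp
end

section
/- In the setting (γ, S, s), for every integer i ≥ 1 one has s_i − 1 ≤ ((m+i+1)/(m+i))^{1/(g−1)} · s_{i−1}, and consequently s_i − 1 ≤ ((m+2)/(m+1))^{1/(g−1)} · s_{i−1}. -/
theorem rpow_div_le_ratio_mul_rpow_div {a b u v c t p : ℝ} (ha : 0 < a) (hb : 0 ≤ b) (hu : 0 < u)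
    (huv : u ≤ v) (hc : 0 ≤ c) (ht : 0 < t) (hp : 0 ≤ p) :
    (b / t / v * c) ^ p ≤ (b / a) ^ p * (a / t / u * c) ^ p := by
  have hv : 0 < v := hu.trans_le huv
  rw [← Real.mul_rpow (by positivity) (by positivity)]
  refine Real.rpow_le_rpow (by positivity) ?_ hp
  calc b / t / v * c ≤ b / t / u * c := by gcongr
    _ = b / a * (a / t / u * c) := by field_simp

theorem natCeil_sub_one_le_mul_natCeil {x y r : ℝ} (hx : 0 ≤ x) (hr : 0 ≤ r) (h : x ≤ r * y) :
    (⌈x⌉₊ : ℝ) - 1 ≤ r * (⌈y⌉₊ : ℝ) := by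
  have h1 := Nat.ceil_lt_add_one hx
  have h2 := mul_le_mul_of_nonneg_left (Nat.le_ceil y) hr
  linarith


/-- In the setting `(γ, S, s)`, for every `i ≥ 1` one has
`s_i - 1 ≤ ((m+i+1)/(m+i))^{1/(g-1)} · s_{i-1}`, and consequently
`s_i - 1 ≤ ((m+2)/(m+1))^{1/(g-1)} · s_{i-1}`. -/
theorem sample_size_ratio_bound
    (g : ℝ) (hg : 1 < g) (d m : ℕ) (γ : ℝ → ℝ)
    (hγdiff : Differentiable ℝ γ)
    (hγmono : MonotoneOn γ (Set.Ici (0 : ℝ)))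
    (hγ1 : ∀ z : ℝ, 0 ≤ z → 1 ≤ γ z)
    (hγderiv : ∀ z : ℝ, 0 ≤ z → z * deriv γ z * g / (g - 1) ≤ γ z)
    (ω S : ℝ → ℝ)
    (hω : ∀ x : ℝ, ω x = γ ((x * (g - 1) / g) ^ (g / (g - 1))))
    (hS : ∀ x : ℝ, S x = (x / ω x * ((g - 1) / g)) ^ (1 / (g - 1)))
    (s : ℕ → ℕ)
    (hs : ∀ i : ℕ, s i =
      ⌈(1 / ((d : ℝ) + 1)) * S (((m : ℝ) + (i : ℝ) + 1) / ((d : ℝ) + 1))⌉₊) :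
    ∀ i : ℕ, 1 ≤ i →
      ((s i : ℝ) - 1 ≤
        (((m : ℝ) + (i : ℝ) + 1) / ((m : ℝ) + (i : ℝ))) ^ (1 / (g - 1)) * (s (i - 1) : ℝ)) ∧
      ((s i : ℝ) - 1 ≤
        (((m : ℝ) + 2) / ((m : ℝ) + 1)) ^ (1 / (g - 1)) * (s (i - 1) : ℝ)) := by
  intro i hi
  obtain ⟨k, rfl⟩ : ∃ k, i = k + 1 := ⟨i - 1, by omega⟩
  have hg0 : 0 < g - 1 := sub_pos.2 hg
  have hgpos : 0 < g := by linarith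
  have hp : 0 ≤ 1 / (g - 1) := by positivity
  have hω1 : ∀ x, 0 ≤ x → 1 ≤ ω x := fun x hx => by
    rw [hω]
    exact hγ1 _ (by positivity)
  have hωmono : ∀ x y, 0 ≤ x → x ≤ y → ω x ≤ ω y := fun x y hx hxy => by
    have hy : 0 ≤ y := hx.trans hxy
    rw [hω, hω]
    refine hγmono (Set.mem_Ici.2 (by positivity)) (Set.mem_Ici.2 (by positivity)) ?_
    gcongr
  have hratio : (s (k + 1) : ℝ) - 1 ≤
      (((m : ℝ) + ((k + 1 : ℕ) : ℝ) + 1) / ((m : ℝ) + ((k + 1 : ℕ) : ℝ))) ^ (1 / (g - 1)) *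
        (s (k + 1 - 1) : ℝ) := by
    rw [hs, hs, Nat.add_sub_cancel, Nat.cast_add_one, ← add_assoc]
    have hmono := hωmono (((m : ℝ) + k + 1) / (d + 1)) (((m : ℝ) + k + 1 + 1) / (d + 1))
      (by positivity)
      (div_le_div_of_nonneg_right (by linarith) (by positivity))
    have hpos := hω1 (((m : ℝ) + k + 1) / (d + 1)) (by positivity)
    have hpos' := hpos.trans hmono
    refine natCeil_sub_one_le_mul_natCeil ?_ (by positivity) ?_
    · rw [hS]
      positivity
    · rw [hS, hS, mul_left_comm]
      gcongr
      exact rpow_div_le_ratio_mul_rpow_div (by positivity) (by positivity) (by linarith) hmono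
        (by positivity) (by positivity) hp
  refine ⟨hratio, hratio.trans ?_⟩
  refine mul_le_mul_of_nonneg_right (Real.rpow_le_rpow (by positivity) ?_ hp) (Nat.cast_nonneg _)
  rw [Nat.cast_add_one, div_le_div_iff₀ (by positivity) (by positivity)]
  have hk : (0 : ℝ) ≤ k := k.cast_nonneg
  linarith
end

section
/- Let s : ℕ → ℕ be a sequence of nonnegative integers, let d be a nonnegative integer, and let τ : ℝ → ℝ be a function such that x ↦ x − τ(x) is nondecreasing. Assume that for every integer i ≥ d, τ(∑_{j=0}^{i} s_j) ≥ 1 + ∑_{j=i−d}^{i} s_j. Then for all integers i ≥ d, all integers k with i − d ≤ k ≤ i, and every integer r ≥ 0, one has ∑_{j=k}^{i} s_j − r ≤ τ(∑_{j=0}^{i} s_j − r − 1). -/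
/-- Invariant `t_delay ≤ τ(t_glob)`: if `x ↦ x - τ(x)` is nondecreasing and
`τ(∑_{j=0}^{i} s_j) ≥ 1 + ∑_{j=i-d}^{i} s_j` for every `i ≥ d`, then for all `i ≥ d`,
all `k` with `i - d ≤ k ≤ i` and every integer `r ≥ 0`:
`∑_{j=k}^{i} s_j - r ≤ τ(∑_{j=0}^{i} s_j - r - 1)`. -/
theorem delay_invariant
    (s : ℕ → ℕ) (d : ℕ) (τ : ℝ → ℝ)
    (hτmono : Monotone fun x : ℝ => x - τ x)
    (hτs : ∀ i : ℕ, d ≤ i →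
      1 + ∑ j ∈ Finset.Icc (i - d) i, (s j : ℝ) ≤
        τ (∑ j ∈ Finset.range (i + 1), (s j : ℝ))) :
    ∀ i : ℕ, d ≤ i → ∀ k : ℕ, i - d ≤ k → k ≤ i → ∀ r : ℕ,
      (∑ j ∈ Finset.Icc k i, (s j : ℝ)) - (r : ℝ) ≤
        τ ((∑ j ∈ Finset.range (i + 1), (s j : ℝ)) - (r : ℝ) - 1) := by
  intro i hi k hk _ r
  have hsum : ∑ j ∈ Finset.Icc k i, (s j : ℝ) ≤ ∑ j ∈ Finset.Icc (i - d) i, (s j : ℝ) :=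
    Finset.sum_le_sum_of_subset_of_nonneg (Finset.Icc_subset_Icc_left hk)
      fun _ _ _ => Nat.cast_nonneg _
  have hr : (0 : ℝ) ≤ r := Nat.cast_nonneg r
  have hle : (∑ j ∈ Finset.range (i + 1), (s j : ℝ)) - (r : ℝ) - 1 ≤
      ∑ j ∈ Finset.range (i + 1), (s j : ℝ) := by linarith
  have hmono := hτmono hle
  dsimp only at hmono
  linarith [hτs i hi]
end

section
/- In the setting (γ, S, s) with g = 2, for every integer i ≥ 1 one has s_i ≤ 3·s_{i−1}. -/
/-- In the setting `(γ, S, s)` with `g = 2`, for every `i ≥ 1` one has `s_i ≤ 3·s_{i-1}`. -/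
theorem sample_size_three_times
    (g : ℝ) (hg : g = 2) (d m : ℕ) (γ : ℝ → ℝ)
    (hγdiff : Differentiable ℝ γ)
    (hγmono : MonotoneOn γ (Set.Ici (0 : ℝ)))
    (hγ1 : ∀ z : ℝ, 0 ≤ z → 1 ≤ γ z)
    (hγderiv : ∀ z : ℝ, 0 ≤ z → z * deriv γ z * g / (g - 1) ≤ γ z)
    (ω S : ℝ → ℝ)
    (hω : ∀ x : ℝ, ω x = γ ((x * (g - 1) / g) ^ (g / (g - 1))))
    (hS : ∀ x : ℝ, S x = (x / ω x * ((g - 1) / g)) ^ (1 / (g - 1)))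
    (s : ℕ → ℕ)
    (hs : ∀ i : ℕ, s i =
      ⌈(1 / ((d : ℝ) + 1)) * S (((m : ℝ) + (i : ℝ) + 1) / ((d : ℝ) + 1))⌉₊) :
    ∀ i : ℕ, 1 ≤ i → s i ≤ 3 * s (i - 1) := by
  intro i hi
  subst hg
  have hω' (x : ℝ) : ω x = γ ((x / 2) ^ (2 : ℕ)) := by
    rw [hω, ← Real.rpow_natCast]; norm_num
  have hS' (x : ℝ) : S x = x / ω x * (1 / 2) := by
    rw [hS]; norm_num
  obtain ⟨j, rfl⟩ : ∃ j, i = j + 1 := ⟨i - 1, by omega⟩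
  rw [Nat.add_sub_cancel]
  have hd : (0 : ℝ) < (d : ℝ) + 1 := by positivity
  -- The ratio `S x / x` is nonincreasing, so `S` at most doubles when its argument does.
  have hS2 : S (((m : ℝ) + ((j + 1 : ℕ) : ℝ) + 1) / ((d : ℝ) + 1)) ≤
      2 * S (((m : ℝ) + (j : ℝ) + 1) / ((d : ℝ) + 1)) := by
    set y := ((m : ℝ) + (j : ℝ) + 1) / ((d : ℝ) + 1) with hy
    set x := ((m : ℝ) + ((j + 1 : ℕ) : ℝ) + 1) / ((d : ℝ) + 1) with hx
    have hy0 : 0 ≤ y := by positivity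
    have hyx : y ≤ x := by
      rw [hx, hy]; push_cast; gcongr; linarith
    have hx2 : x ≤ 2 * y := by
      rw [hx, hy, ← mul_div_assoc]
      push_cast
      gcongr
      have := Nat.cast_nonneg (α := ℝ) m
      have := Nat.cast_nonneg (α := ℝ) j
      linarith
    have hωy : 1 ≤ ω y := by rw [hω']; exact hγ1 _ (by positivity)
    have hωyx : ω y ≤ ω x := by
      rw [hω', hω']
      exact hγmono (Set.mem_Ici.2 (by positivity)) (Set.mem_Ici.2 (by positivity)) (by gcongr)
    have hdiv : x / ω x ≤ 2 * y / ω y :=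
      div_le_div₀ (by positivity) hx2 (by linarith) hωyx
    rw [hS', hS']
    rw [mul_div_assoc] at hdiv
    linarith
  have hceil : s (j + 1) ≤ 2 * s j := by
    rw [hs (j + 1)]
    refine Nat.ceil_le.2 ?_
    have hle := Nat.le_ceil ((1 / ((d : ℝ) + 1)) * S (((m : ℝ) + (j : ℝ) + 1) / ((d : ℝ) + 1)))
    rw [← hs j] at hle
    have hmul := mul_le_mul_of_nonneg_left hS2 (by positivity : 0 ≤ 1 / ((d : ℝ) + 1))
    push_cast at hmul ⊢
    linarith
  omega
end

section
/- Let d and m be nonnegative integers with (m+1)/(2(d+1)) ≥ e², and let M₁ ≥ d + 2 be a real number. Set M₀ = (m+1)²/4, define the sample size sequence s_i = ⌈(m+i+1)/(16·(d+1)²·ln((m+i+1)/(2(d+1))))⌉ for i ∈ ℕ, and the delay function τ(t) = M₁ + √((t + M₀)/(4·ln(t + M₀))). Then for every integer i ≥ d, τ(∑_{j=0}^{i} s_j) ≥ 1 + ∑_{j=i−d}^{i} s_j. -/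
/-- The function `x / log x` is monotone on `[e, ∞)`. -/
theorem div_log_le_div_log {x y : ℝ} (hx : Real.exp 1 ≤ x) (hxy : x ≤ y) :
    x / Real.log x ≤ y / Real.log y := by
  have h := Real.log_div_self_antitoneOn (show x ∈ {x | Real.exp 1 ≤ x} from hx)
    (show y ∈ {x | Real.exp 1 ≤ x} from hx.trans hxy) hxy
  have hy0 : 0 < y := (Real.exp_pos 1).trans_le (hx.trans hxy)
  have hly : 1 ≤ Real.log y := (Real.le_log_iff_exp_le hy0).2 (hx.trans hxy)
  rw [← inv_div, ← inv_div (Real.log y)]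
  exact inv_anti₀ (by positivity) h

theorem two_le_log {x : ℝ} (hx : Real.exp 2 ≤ x) : 2 ≤ Real.log x :=
  (Real.le_log_iff_exp_le ((Real.exp_pos 2).trans_le hx)).2 hx

theorem exp_one_le_sq_div_log {x : ℝ} (hx : Real.exp 2 ≤ x) :
    Real.exp 1 ≤ x ^ 2 / (8 * Real.log x) := by
  have hmono := div_log_le_div_log (Real.exp_le_exp.2 (by norm_num : (1 : ℝ) ≤ 2)) hx
  rw [Real.log_exp] at hmono
  have hL := two_le_log hx
  have he := Real.exp_one_gt_d9
  have he2 : Real.exp 2 = Real.exp 1 ^ 2 := by rw [← Real.exp_nat_mul]; norm_num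
  have h7 : 7 ≤ Real.exp 2 := by rw [he2]; nlinarith
  have h8 : x ^ 2 / (8 * Real.log x) = x * (x / Real.log x) / 8 := by field_simp
  rw [h8]
  have h9 : Real.exp 2 * (Real.exp 2 / 2) ≤ x * (x / Real.log x) :=
    mul_le_mul hx hmono (by positivity) ((Real.exp_pos 2).le.trans hx)
  nlinarith [Real.exp_one_lt_d9]

theorem div_log_le_sqrt {x T : ℝ} (hx : Real.exp 2 ≤ x)
    (hT : x ^ 2 / (8 * Real.log x) ≤ T) :
    x / (8 * Real.log x) ≤ Real.sqrt (T / (4 * Real.log T)) := by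
  have hL := two_le_log hx
  have hx0 : 0 < x := (Real.exp_pos 2).trans_le hx
  have he := exp_one_le_sq_div_log hx
  have hmono := div_log_le_div_log he hT
  set t := x ^ 2 / (8 * Real.log x) with ht
  have ht0 : 0 < t := by positivity
  have hlt : Real.log t ≤ 2 * Real.log x := by
    have : t ≤ x ^ 2 := div_le_self (by positivity) (by linarith)
    calc Real.log t ≤ Real.log (x ^ 2) := Real.log_le_log ht0 this
      _ = 2 * Real.log x := by rw [Real.log_pow]; norm_num
  have hlt0 : 1 ≤ Real.log t := (Real.le_log_iff_exp_le ht0).2 he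
  have h1 : t / (2 * Real.log x) ≤ t / Real.log t :=
    div_le_div_of_nonneg_left ht0.le (by linarith) hlt
  apply Real.le_sqrt_of_sq_le
  calc (x / (8 * Real.log x)) ^ 2 = t / (2 * Real.log x) / 4 := by
        rw [ht]; field_simp; norm_num
    _ ≤ T / Real.log T / 4 := by linarith
    _ = T / (4 * Real.log T) := by rw [div_div, mul_comm]

/-- Increments of `x² / log x` are at most `2 y (y - x) / log y`. -/
theorem sq_div_log_le_add {x y : ℝ} (hx : Real.exp 2 ≤ x) (hxy : x ≤ y) :
    y ^ 2 / (8 * Real.log y) ≤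
      x ^ 2 / (8 * Real.log x) + 2 * (y - x) * (y / (8 * Real.log y)) := by
  have hL := two_le_log hx
  have hx0 : 0 < x := (Real.exp_pos 2).trans_le hx
  have hLL : Real.log x ≤ Real.log y := Real.log_le_log hx0 hxy
  have h1 : x ^ 2 / (8 * Real.log y) ≤ x ^ 2 / (8 * Real.log x) :=
    div_le_div_of_nonneg_left (by positivity) (by linarith) (by linarith)
  have h2 : y ^ 2 / (8 * Real.log y) ≤
      (x ^ 2 + 2 * (y - x) * y) / (8 * Real.log y) :=
    div_le_div_of_nonneg_right (by nlinarith [sq_nonneg (y - x)]) (by linarith)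
  rw [add_div, mul_div_assoc] at h2
  linarith


/-- The `Θ(i/ln i)` sample size sequence for strongly convex problems: for `d, m` with
`(m+1)/(2(d+1)) ≥ e²`, `M₁ ≥ d + 2`, `M₀ = (m+1)²/4`, the sequence
`s_i = ⌈(m+i+1)/(16(d+1)²·ln((m+i+1)/(2(d+1))))⌉` and the delay function
`τ(t) = M₁ + √((t + M₀)/(4·ln(t + M₀)))` satisfy
`τ(∑_{j=0}^{i} s_j) ≥ 1 + ∑_{j=i-d}^{i} s_j` for every `i ≥ d`. -/
theorem strongly_convex_sample_size_property
    (d m : ℕ)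
    (hdm : Real.exp 2 ≤ ((m : ℝ) + 1) / (2 * ((d : ℝ) + 1)))
    (M₁ : ℝ) (hM₁ : (d : ℝ) + 2 ≤ M₁)
    (M₀ : ℝ) (hM₀ : M₀ = ((m : ℝ) + 1) ^ 2 / 4)
    (s : ℕ → ℕ)
    (hs : ∀ i : ℕ, s i =
      ⌈((m : ℝ) + (i : ℝ) + 1) /
        (16 * ((d : ℝ) + 1) ^ 2 *
          Real.log (((m : ℝ) + (i : ℝ) + 1) / (2 * ((d : ℝ) + 1))))⌉₊)
    (τ : ℝ → ℝ)
    (hτ : ∀ t : ℝ, τ t = M₁ + Real.sqrt ((t + M₀) / (4 * Real.log (t + M₀)))) :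
    ∀ i : ℕ, d ≤ i →
      1 + ∑ j ∈ Finset.Icc (i - d) i, (s j : ℝ) ≤
        τ (∑ j ∈ Finset.range (i + 1), (s j : ℝ)) := by
  intro i hi
  set D : ℝ := (d : ℝ) + 1 with hD
  have hD1 : 1 ≤ D := by rw [hD]; linarith [(Nat.cast_nonneg d : (0 : ℝ) ≤ d)]
  have hD0 : 0 < D := by linarith
  set x : ℕ → ℝ := fun j => ((m : ℝ) + (j : ℝ) + 1) / (2 * D) with hxdef
  have hxmono : Monotone x := by
    intro a b hab
    have hab' : (a : ℝ) ≤ b := Nat.cast_le.2 hab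
    exact div_le_div_of_nonneg_right (by linarith) (by linarith)
  have hx0 : x 0 = ((m : ℝ) + 1) / (2 * D) := by simp [hxdef]
  have hx : ∀ j, Real.exp 2 ≤ x j := fun j =>
    (hdm.trans_eq hx0.symm).trans (hxmono (Nat.zero_le j))
  have hxpos : ∀ j, 0 < x j := fun j => (Real.exp_pos 2).trans_le (hx j)
  have harg : ∀ j : ℕ, ((m : ℝ) + (j : ℝ) + 1) / (16 * D ^ 2 *
      Real.log (((m : ℝ) + (j : ℝ) + 1) / (2 * D))) =
        x j / (8 * Real.log (x j)) / D := by
    intro j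
    have hL := two_le_log (hx j)
    change _ / (16 * D ^ 2 * Real.log (x j)) = _
    have hm : (m : ℝ) + (j : ℝ) + 1 = x j * (2 * D) := by
      simp only [hxdef]; field_simp
    rw [hm]
    field_simp
    ring
  have hlow : ∀ j, x j / (8 * Real.log (x j)) / D ≤ s j := by
    intro j
    rw [hs j, harg j]
    exact Nat.le_ceil _
  have hup : ∀ j, (s j : ℝ) ≤ x j / (8 * Real.log (x j)) / D + 1 := by
    intro j
    have hL := two_le_log (hx j)
    have := hxpos j
    rw [hs j, harg j]
    exact (Nat.ceil_lt_add_one (by positivity)).le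
  have hwindow : ∑ j ∈ Finset.Icc (i - d) i, (s j : ℝ) ≤
      x i / (8 * Real.log (x i)) + D := by
    have hb : ∀ j ∈ Finset.Icc (i - d) i,
        (s j : ℝ) ≤ x i / (8 * Real.log (x i)) / D + 1 := by
      intro j hj
      refine (hup j).trans ?_
      have h := div_log_le_div_log
        ((Real.exp_le_exp.2 (by norm_num : (1 : ℝ) ≤ 2)).trans (hx j))
        (hxmono (Finset.mem_Icc.1 hj).2)
      rw [mul_comm 8, ← div_div, mul_comm 8, ← div_div]
      gcongr
    have hcard : ((Finset.Icc (i - d) i).card : ℝ) = D := by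
      rw [Nat.card_Icc, show i + 1 - (i - d) = d + 1 by omega, hD]
      push_cast
      rfl
    refine (Finset.sum_le_card_nsmul _ _ _ hb).trans_eq ?_
    rw [nsmul_eq_mul, hcard]
    field_simp
  have htotal : ∀ n : ℕ, x n ^ 2 / (8 * Real.log (x n)) ≤
      ∑ j ∈ Finset.range (n + 1), (s j : ℝ) + M₀ := by
    intro n
    induction n with
    | zero =>
      have hL := two_le_log (hx 0)
      have h1 : x 0 ^ 2 / (8 * Real.log (x 0)) ≤ x 0 ^ 2 :=
        div_le_self (by positivity) (by linarith)
      have h2 : M₀ = D ^ 2 * x 0 ^ 2 := by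
        rw [hM₀, hx0]; field_simp; norm_num
      have h3 : x 0 ^ 2 ≤ D ^ 2 * x 0 ^ 2 :=
        le_mul_of_one_le_left (by positivity) (one_le_pow₀ hD1)
      have h4 : (0 : ℝ) ≤ s 0 := Nat.cast_nonneg _
      rw [zero_add, Finset.sum_range_one]
      linarith
    | succ n ih =>
      have h := sq_div_log_le_add (hx n) (hxmono (Nat.le_succ n))
      have hstep : 2 * (x (n + 1) - x n) = 1 / D := by
        simp only [hxdef]; push_cast; field_simp; ring
      rw [Nat.succ_eq_add_one, hstep, one_div_mul_eq_div] at h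
      rw [Finset.sum_range_succ]
      linarith [hlow (n + 1)]
  rw [hτ]
  linarith [div_log_le_sqrt (hx i) (htotal i)]
end

section
/- In the setting (γ, S, s), let E : ℕ → ℝ be nondecreasing with E_t ≥ 1 for all t; define Ē_i = E_{A_i} for i ≥ 0 and Ē_{−1} = E_0, and assume Ē_i ≤ 2·Ē_{i−1} for all i ≥ 0. Let q ≥ 0 be real. Then for every integer i ≥ 1 and every integer t with A_{i−1} ≤ t ≤ A_i − 1, one has (t + E_t)^q / (A_{i−1} + Ē_{i−1})^q ≤ (1 + ((m+2)/(m+1))^{1/(g−1)})^q. -/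
/-- In the setting `(γ, S, s)`, with a nondecreasing sequence `E_t ≥ 1` and
`Ē_i = E_{A_i}` (with `Ē_{-1} = E₀`) satisfying `Ē_i ≤ 2·Ē_{i-1}` for all `i ≥ 0`, for
`q ≥ 0`, every `i ≥ 1` and every `t` with `A_{i-1} ≤ t ≤ A_i - 1`:
`(t + E_t)^q / (A_{i-1} + Ē_{i-1})^q ≤ (1 + ((m+2)/(m+1))^{1/(g-1)})^q`.
Here `P i = ∑_{j=0}^{i-1} s_j = A_{i-1}` (so `P 0 = 0`) and `Ebar i = E_{P i} = Ē_{i-1}`. -/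
theorem round_ratio_bound
    (g : ℝ) (hg : 1 < g) (d m : ℕ) (γ : ℝ → ℝ)
    (hγdiff : Differentiable ℝ γ)
    (hγmono : MonotoneOn γ (Set.Ici (0 : ℝ)))
    (hγ1 : ∀ z : ℝ, 0 ≤ z → 1 ≤ γ z)
    (hγderiv : ∀ z : ℝ, 0 ≤ z → z * deriv γ z * g / (g - 1) ≤ γ z)
    (ω S : ℝ → ℝ)
    (hω : ∀ x : ℝ, ω x = γ ((x * (g - 1) / g) ^ (g / (g - 1))))
    (hS : ∀ x : ℝ, S x = (x / ω x * ((g - 1) / g)) ^ (1 / (g - 1)))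
    (s : ℕ → ℕ)
    (hs : ∀ i : ℕ, s i =
      ⌈(1 / ((d : ℝ) + 1)) * S (((m : ℝ) + (i : ℝ) + 1) / ((d : ℝ) + 1))⌉₊)
    (P : ℕ → ℕ) (hP : ∀ i : ℕ, P i = ∑ j ∈ Finset.range i, s j)
    (E : ℕ → ℝ) (hEmono : Monotone E) (hE1 : ∀ t : ℕ, 1 ≤ E t)
    (Ebar : ℕ → ℝ) (hEbar : ∀ i : ℕ, Ebar i = E (P i))
    (hEbar2 : ∀ i : ℕ, Ebar (i + 1) ≤ 2 * Ebar i)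
    (q : ℝ) (hq : 0 ≤ q) :
    ∀ i : ℕ, 1 ≤ i → ∀ t : ℕ, P i ≤ t → t ≤ P (i + 1) - 1 →
      ((t : ℝ) + E t) ^ q / ((P i : ℝ) + Ebar i) ^ q ≤
        (1 + (((m : ℝ) + 2) / ((m : ℝ) + 1)) ^ (1 / (g - 1))) ^ q := by
  intro i hi t hPt htP
  obtain ⟨k, rfl⟩ : ∃ k, i = k + 1 := ⟨i - 1, by omega⟩
  have hg0 : 0 < g - 1 := by linarith
  have he : 0 ≤ 1 / (g - 1) := by positivity
  set ρ : ℝ := (((m : ℝ) + 2) / ((m : ℝ) + 1)) ^ (1 / (g - 1)) with hρ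
  have hρ1 : 1 ≤ ρ :=
    Real.one_le_rpow (by rw [le_div_iff₀ (by positivity)]; linarith) he
  have hc : 0 ≤ (g - 1) / g := by positivity
  have hωpos : ∀ x : ℝ, 0 ≤ x → 0 < ω x := fun x hx => by
    rw [hω]
    exact one_pos.trans_le (hγ1 _ (by positivity))
  have hωmono : ∀ x y : ℝ, 0 ≤ x → x ≤ y → ω x ≤ ω y := fun x y hx hxy => by
    have hy := hx.trans hxy
    rw [hω, hω]
    refine hγmono (Set.mem_Ici.2 (by positivity)) (Set.mem_Ici.2 (by positivity)) ?_
    gcongr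
  have hS0 : ∀ x : ℝ, 0 ≤ x → 0 ≤ S x := fun x hx => by
    have := hωpos x hx
    rw [hS]
    positivity
  set x : ℝ := ((m : ℝ) + (k : ℝ) + 1) / ((d : ℝ) + 1) with hx
  set y : ℝ := ((m : ℝ) + ((k + 1 : ℕ) : ℝ) + 1) / ((d : ℝ) + 1) with hy
  have hx0 : 0 ≤ x := by positivity
  have hy0 : 0 ≤ y := by positivity
  have hxy : x ≤ y := by
    rw [hx, hy]
    push_cast
    gcongr
    linarith
  have hyx : y ≤ ((m : ℝ) + 2) / ((m : ℝ) + 1) * x := by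
    rw [hx, hy, div_mul_div_comm, div_le_div_iff₀ (by positivity) (by positivity)]
    push_cast
    have hk : (0 : ℝ) ≤ k * (d + 1) := by positivity
    nlinarith
  have hSyx : S y ≤ ρ * S x := by
    have hωx := hωpos x hx0
    have hωy := hωpos y hy0
    rw [hS, hS, hρ, ← Real.mul_rpow (by positivity) (by positivity)]
    refine Real.rpow_le_rpow (by positivity) ?_ he
    rw [← mul_assoc]
    refine mul_le_mul_of_nonneg_right ?_ hc
    rw [← mul_div_assoc]
    exact div_le_div₀ (by positivity) hyx hωx (hωmono x y hx0 hxy)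
  have hsx : 1 / ((d : ℝ) + 1) * S x ≤ s k := by
    rw [hs k]
    exact Nat.le_ceil _
  have hsy : (s (k + 1) : ℝ) < 1 / ((d : ℝ) + 1) * S y + 1 := by
    rw [hs (k + 1)]
    exact Nat.ceil_lt_add_one (mul_nonneg (by positivity) (hS0 y hy0))
  have hstep : 1 / ((d : ℝ) + 1) * S y ≤ ρ * s k :=
    calc 1 / ((d : ℝ) + 1) * S y ≤ 1 / ((d : ℝ) + 1) * (ρ * S x) := by gcongr
      _ = ρ * (1 / ((d : ℝ) + 1) * S x) := by ring
      _ ≤ ρ * s k := by gcongr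
  have hPsucc : ∀ j, P (j + 1) = P j + s j := fun j => by
    rw [hP, hP, Finset.sum_range_succ]
  have hskP : (s k : ℝ) ≤ P (k + 1) := by
    rw [hPsucc k]
    exact_mod_cast Nat.le_add_left _ _
  have ht : (t : ℝ) ≤ (1 + ρ) * P (k + 1) := by
    rcases hPt.eq_or_lt with h | h
    · rw [← h]
      exact le_mul_of_one_le_left (by positivity) (by linarith)
    · have h1 : t + 1 ≤ P (k + 1) + s (k + 1) := by
        have := hPsucc (k + 1)
        omega
      have h2 : (t : ℝ) + 1 ≤ P (k + 1) + s (k + 1) := by exact_mod_cast h1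
      have h3 : ρ * s k ≤ ρ * P (k + 1) := by gcongr
      linarith
  have hEbar1 : 1 ≤ Ebar (k + 1) := by
    rw [hEbar]
    exact hE1 _
  have hEt : E t ≤ (1 + ρ) * Ebar (k + 1) :=
    calc E t ≤ Ebar (k + 1 + 1) := by
          rw [hEbar]
          exact hEmono (htP.trans (Nat.sub_le _ _))
      _ ≤ 2 * Ebar (k + 1) := hEbar2 _
      _ ≤ (1 + ρ) * Ebar (k + 1) := by
          gcongr
          linarith
  have hden : 0 < (P (k + 1) : ℝ) + Ebar (k + 1) := by positivity
  have hnum : 0 ≤ (t : ℝ) + E t := add_nonneg t.cast_nonneg (zero_le_one.trans (hE1 t))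
  rw [← Real.div_rpow hnum hden.le]
  refine Real.rpow_le_rpow (div_nonneg hnum hden.le) ?_ hq
  rw [div_le_iff₀ hden, mul_add]
  exact add_le_add ht hEt
end

section
/- Let g > 1 be real, let γ : ℝ → ℝ be nondecreasing on [0,∞) with γ(z) ≥ 1 for all z ≥ 0, and let x > 0 and w ≥ 1 be reals with γ((x·(g−1)/g)^{g/(g−1)}) ≤ w. Set y = (x·(g−1)/g)^{g/(g−1)} / w^{1/(g−1)}. Then y^{1/g} / γ(y)^{1/g} ≥ ((x/w)·(g−1)/g)^{1/(g−1)}. -/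
/-- For `g > 1`, `γ` nondecreasing on `[0,∞)` with `γ(z) ≥ 1` for `z ≥ 0`, `x > 0` and
`w ≥ 1` with `γ((x·(g-1)/g)^{g/(g-1)}) ≤ w`, setting
`y = (x·(g-1)/g)^{g/(g-1)} / w^{1/(g-1)}` we have
`y^{1/g}/γ(y)^{1/g} ≥ ((x/w)·(g-1)/g)^{1/(g-1)}`. -/
theorem final_inequality_sample_size
    (g : ℝ) (hg : 1 < g) (γ : ℝ → ℝ)
    (hγmono : MonotoneOn γ (Set.Ici (0 : ℝ)))
    (hγ1 : ∀ z : ℝ, 0 ≤ z → 1 ≤ γ z)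
    (x w : ℝ) (hx : 0 < x) (hw : 1 ≤ w)
    (hγw : γ ((x * (g - 1) / g) ^ (g / (g - 1))) ≤ w)
    (y : ℝ) (hy : y = (x * (g - 1) / g) ^ (g / (g - 1)) / w ^ (1 / (g - 1))) :
    (x / w * ((g - 1) / g)) ^ (1 / (g - 1)) ≤ y ^ (1 / g) / (γ y) ^ (1 / g) := by
  have hg0 : 0 < g := by linarith
  have hg1 : 0 < g - 1 := by linarith
  have hw0 : 0 < w := by linarith
  have hA : 0 < x * (g - 1) / g := by positivity
  have hbase : x / w * ((g - 1) / g) = x * (g - 1) / g / w := by ring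
  rw [hbase]
  generalize x * (g - 1) / g = A at *
  have hy0 : 0 < y := by rw [hy]; positivity
  have hyA : y ≤ A ^ (g / (g - 1)) := by
    rw [hy]
    exact div_le_self (by positivity) (Real.one_le_rpow hw (by positivity))
  have hγyw : γ y ≤ w :=
    (hγmono hy0.le (Real.rpow_nonneg hA.le _) hyA).trans hγw
  have hγy : 0 < γ y := zero_lt_one.trans_le (hγ1 y hy0.le)
  have hexpA : g / (g - 1) * (1 / g) = 1 / (g - 1) := by field_simp
  have hexpw : 1 / (g - 1) = 1 / (g - 1) * (1 / g) + 1 / g := by field_simp; ring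
  calc (A / w) ^ (1 / (g - 1)) = y ^ (1 / g) / w ^ (1 / g) := by
        rw [hy, Real.div_rpow hA.le hw0.le,
          Real.div_rpow (Real.rpow_nonneg hA.le _) (Real.rpow_nonneg hw0.le _), ← Real.rpow_mul hA.le,
          ← Real.rpow_mul hw0.le, hexpA, div_div, ← Real.rpow_add hw0, ← hexpw]
    _ ≤ y ^ (1 / g) / γ y ^ (1 / g) := by gcongr
end
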